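/- arXiv:1605.02077 — 2 statements merged into one kernel-verified Lean document; each statement's English description precedes it below -/
import Mathlib

section
/- Let ε ∈ (0,1), suppose d_f(π₀ᵀ Pᵗ, π) ≤ ε/2 for every t ∈ {0,1,…,T_f(ε/2)−1}, and let N be a positive integer multiple of T_f(ε/2). Then: (i) if ε > 2·λ_f/√πmin, then T_f(ε/2) = 1 and P[ (1/N)·∑_{n=1}^N f(X_n) ≥ μ + ε ] ≤ exp(−ε² N / 8); (ii) if 0 < ε ≤ 2·λ_f/√πmin (so that λ_f > 0), then T_f(ε/2) ≤ ⌈ log(2/(ε·√πmin)) / log(1/λ_f) ⌉ and consequently P[ (1/N)·∑_{n=1}^N f(X_n) ≥ μ + ε ] ≤ exp( − ε² N / ( 8·⌈ log(2/(ε·√πmin)) / log(1/λ_f) ⌉ ) ). -/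
open Finset

noncomputable section MarkovSetup

variable {d : ℕ}

/-- `P` is a transition matrix: nonnegative entries, rows summing to one. -/
def IsTransMat (P : Matrix (Fin d) (Fin d) ℝ) : Prop :=
  (∀ i j, 0 ≤ P i j) ∧ (∀ i, ∑ j, P i j = 1)

/-- Irreducibility of the chain. -/
def IsIrreducibleMat (P : Matrix (Fin d) (Fin d) ℝ) : Prop :=
  ∀ i j, ∃ n : ℕ, 0 < (P ^ n) i j

/-- Aperiodicity of the chain (for each state, eventually positive return probabilities). -/
def IsAperiodicMat (P : Matrix (Fin d) (Fin d) ℝ) : Prop :=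
  ∀ i, ∃ N : ℕ, ∀ n, N ≤ n → 0 < (P ^ n) i i

/-- A probability vector. -/
def IsProbVec (p : Fin d → ℝ) : Prop := (∀ i, 0 ≤ p i) ∧ ∑ i, p i = 1

/-- `π` is the stationary distribution of `P`, with strictly positive entries. -/
def IsStationaryDist (P : Matrix (Fin d) (Fin d) ℝ) (π : Fin d → ℝ) : Prop :=
  (∀ i, 0 < π i) ∧ (∑ i, π i = 1) ∧ (∀ j, ∑ i, π i * P i j = π j)

/-- Reversibility of `P` with respect to `π`. -/
def IsReversibleMat (P : Matrix (Fin d) (Fin d) ℝ) (π : Fin d → ℝ) : Prop :=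
  ∀ i j, π i * P i j = π j * P j i

/-- The `f`-discrepancy `d_f(p, q) = |∑ᵢ pᵢ fᵢ − ∑ᵢ qᵢ fᵢ|`. -/
def fDisc (f p q : Fin d → ℝ) : ℝ := |∑ i, p i * f i - ∑ i, q i * f i|

/-- The `f`-mixing time `T_f(δ) = min {n ≥ 1 : ∀ i, d_f(δᵢᵀ Pⁿ, π) ≤ δ}`. -/
def fMixTime (P : Matrix (Fin d) (Fin d) ℝ) (π f : Fin d → ℝ) (δ : ℝ) : ℕ :=
  sInf {n : ℕ | 1 ≤ n ∧ ∀ i, fDisc f (fun j => (P ^ n) i j) π ≤ δ}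

/-- Total variation distance between probability vectors. -/
def tvDist (p q : Fin d → ℝ) : ℝ := (1 / 2) * ∑ i, |p i - q i|

/-- Mass of a trajectory `(X₀, …, X_N)` under the chain `P` started from `π₀`. -/
def pathMass (P : Matrix (Fin d) (Fin d) ℝ) (π₀ : Fin d → ℝ) (N : ℕ)
    (x : Fin (N + 1) → Fin d) : ℝ :=
  π₀ (x 0) * ∏ n : Fin N, P (x n.castSucc) (x n.succ)

open scoped Classical in
/-- Probability of an event under the trajectory law of `(X₀, …, X_N)`. -/
def pathProb (P : Matrix (Fin d) (Fin d) ℝ) (π₀ : Fin d → ℝ) (N : ℕ)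
    (E : (Fin (N + 1) → Fin d) → Prop) : ℝ :=
  ∑ x : Fin (N + 1) → Fin d, if E x then pathMass P π₀ N x else 0

/-- Expectation of a functional of the trajectory `(X₀, …, X_N)`. -/
def pathExp (P : Matrix (Fin d) (Fin d) ℝ) (π₀ : Fin d → ℝ) (N : ℕ)
    (g : (Fin (N + 1) → Fin d) → ℝ) : ℝ :=
  ∑ x : Fin (N + 1) → Fin d, pathMass P π₀ N x * g x

end MarkovSetup

/-- Expected weighted product over `n` remaining steps. -/
noncomputable def remVal {d : ℕ} (P : Matrix (Fin d) (Fin d) ℝ) (v : ℕ → Fin d → ℝ) :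
    ℕ → Fin d → ℝ
  | 0 => fun _ => 1
  | n + 1 => P.mulVec (fun j => v n j * remVal P v n j)

lemma pathExp_prod {d : ℕ} (P : Matrix (Fin d) (Fin d) ℝ) (v : ℕ → Fin d → ℝ) (N : ℕ) :
    ∀ π₀ : Fin d → ℝ,
    pathExp P π₀ N (fun x => ∏ n : Fin N, v (N - 1 - n) (x n.succ)) =
      ∑ i, π₀ i * remVal P v N i := by
  induction N with
  | zero =>
    intro π₀
    simp only [pathExp, pathMass, remVal]
    rw [← (Equiv.funUnique (Fin 1) (Fin d)).symm.sum_comp]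
    simp
  | succ N ih =>
    intro π₀
    have key := ih (fun j => (∑ i, π₀ i * P i j) * v N j)
    have lhs : pathExp P π₀ (N + 1)
        (fun x => ∏ n : Fin (N + 1), v (N + 1 - 1 - n) (x n.succ)) =
        pathExp P (fun j => (∑ i, π₀ i * P i j) * v N j) N
          (fun x => ∏ n : Fin N, v (N - 1 - n) (x n.succ)) := by
      simp only [pathExp, pathMass]
      rw [← (Fin.consEquiv (fun _ : Fin (N + 2) => Fin d)).sum_comp,
        Fintype.sum_prod_type, Finset.sum_comm]
      refine Finset.sum_congr rfl fun y _ => ?_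
      simp only [Finset.sum_mul]
      refine Finset.sum_congr rfl fun i _ => ?_
      simp only [Fin.consEquiv_apply, Fin.cons_zero, Fin.cons_succ, Fin.prod_univ_succ (n := N),
        Fin.castSucc_zero]
      have h1 : ∀ n : Fin N, (Fin.cons i y : Fin (N + 2) → Fin d) (n.succ.castSucc)
          = y n.castSucc := fun n => by
        rw [← Fin.succ_castSucc, Fin.cons_succ]
      have h2 : ∀ n : Fin N, N + 1 - 1 - ((n.succ : Fin (N + 1)) : ℕ) = N - 1 - n := fun n => by
        simp; omega
      simp only [h1, h2]
      simp
      ring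
    rw [lhs, key]
    simp only [remVal, Matrix.mulVec, dotProduct, Finset.mul_sum, Finset.sum_mul]
    rw [Finset.sum_comm]
    refine Finset.sum_congr rfl fun i _ => Finset.sum_congr rfl fun j _ => ?_
    ring

lemma transMat_pow {d : ℕ} {P : Matrix (Fin d) (Fin d) ℝ} (hP : IsTransMat P) (n : ℕ) :
    IsTransMat (P ^ n) := by
  induction n with
  | zero =>
    refine ⟨fun i j => ?_, fun i => ?_⟩
    · rw [pow_zero, Matrix.one_apply]; split_ifs <;> norm_num
    · simp [Matrix.one_apply]
  | succ n ih =>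
    refine ⟨fun i j => ?_, fun i => ?_⟩
    · rw [pow_succ, Matrix.mul_apply]
      exact Finset.sum_nonneg fun k _ => mul_nonneg (ih.1 i k) (hP.1 k j)
    · simp only [pow_succ, Matrix.mul_apply]
      rw [Finset.sum_comm]
      simp [← Finset.mul_sum, hP.2, ih.2]

lemma remVal_skip {d : ℕ} (P : Matrix (Fin d) (Fin d) ℝ) (v : ℕ → Fin d → ℝ) (n k : ℕ)
    (h : ∀ t, 1 ≤ t → t ≤ k → ∀ j, v (n + t) j = 1) :
    remVal P v (n + k + 1) = (P ^ (k + 1)).mulVec (fun j => v n j * remVal P v n j) := by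
  induction k with
  | zero => simp [remVal]
  | succ k ih =>
    have h1 := ih (fun t h1 h2 => h t h1 (by omega))
    rw [show n + (k + 1) + 1 = (n + k + 1) + 1 by ring, remVal, h1]
    have h2 : ∀ j, v (n + k + 1) j = 1 := h (k + 1) (by omega) le_rfl
    simp only [h2, one_mul]
    rw [pow_succ' P (k + 1), ← Matrix.mulVec_mulVec]

lemma mgf_bound {d : ℕ} (p f : Fin d → ℝ) (hp : IsProbVec p)
    (hf : ∀ i, f i ∈ Set.Icc (0 : ℝ) 1) (s c : ℝ) (hs : 0 ≤ s) (hc : ∑ i, p i * f i ≤ c) :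
    ∑ i, p i * Real.exp (s * f i) ≤ Real.exp (s * c + s ^ 2 / 2) := by
  set m := ∑ i, p i * f i with hm
  have hm0 : 0 ≤ m := Finset.sum_nonneg fun i _ => mul_nonneg (hp.1 i) (hf i).1
  have hm1 : m ≤ 1 := by
    rw [← hp.2]
    exact Finset.sum_le_sum fun i _ => mul_le_of_le_one_right (hp.1 i) (hf i).2
  have hpt : ∀ x : ℝ, -1 ≤ x → x ≤ 1 → Real.exp (s * x) ≤ Real.cosh s + x * Real.sinh s := by
    intro x h1 h2
    have := convexOn_exp.2 (Set.mem_univ s) (Set.mem_univ (-s))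
      (show 0 ≤ (1 + x) / 2 by linarith) (show 0 ≤ (1 - x) / 2 by linarith) (by ring)
    simp only [smul_eq_mul] at this
    rw [Real.cosh_eq, Real.sinh_eq]
    calc Real.exp (s * x) = Real.exp ((1 + x) / 2 * s + (1 - x) / 2 * -s) := by ring_nf
      _ ≤ _ := this
      _ = _ := by ring
  have h1 : ∑ i, p i * Real.exp (s * f i) =
      Real.exp (s * m) * ∑ i, p i * Real.exp (s * (f i - m)) := by
    rw [Finset.mul_sum]
    refine Finset.sum_congr rfl fun i _ => ?_
    rw [show s * f i = s * m + s * (f i - m) by ring, Real.exp_add]; ring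
  have h2 : ∑ i, p i * Real.exp (s * (f i - m)) ≤ Real.cosh s := by
    calc _ ≤ ∑ i, p i * (Real.cosh s + (f i - m) * Real.sinh s) :=
          Finset.sum_le_sum fun i _ => mul_le_mul_of_nonneg_left
            (hpt _ (by linarith [(hf i).1]) (by linarith [(hf i).2])) (hp.1 i)
      _ = (∑ i, p i) * Real.cosh s + (∑ i, p i * f i) * Real.sinh s
            - (∑ i, p i) * (m * Real.sinh s) := by
          simp only [Finset.sum_mul, ← Finset.sum_add_distrib, ← Finset.sum_sub_distrib]
          refine Finset.sum_congr rfl fun i _ => ?_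
          ring
      _ = Real.cosh s := by rw [hp.2, ← hm]; ring
  rw [h1]
  calc _ ≤ Real.exp (s * m) * Real.exp (s ^ 2 / 2) :=
        mul_le_mul_of_nonneg_left (h2.trans (Real.cosh_le_exp_half_sq s)) (Real.exp_pos _).le
    _ = Real.exp (s * m + s ^ 2 / 2) := by rw [Real.exp_add]
    _ ≤ _ := Real.exp_le_exp.2 (by nlinarith)

/-- Weight of the residue class `r` modulo `T`. -/
noncomputable def resWt {d : ℕ} (f : Fin d → ℝ) (s : ℝ) (T r : ℕ) (n : ℕ) (j : Fin d) : ℝ :=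
  if n % T = r then Real.exp (s * f j) else 1

lemma mulVec_mono {d : ℕ} {P : Matrix (Fin d) (Fin d) ℝ} (hP : IsTransMat P)
    {a b : Fin d → ℝ} (h : ∀ i, a i ≤ b i) (i : Fin d) : P.mulVec a i ≤ P.mulVec b i := by
  simp only [Matrix.mulVec, dotProduct]
  exact Finset.sum_le_sum fun j _ => mul_le_mul_of_nonneg_left (h j) (hP.1 i j)

lemma resWt_ne {d : ℕ} (f : Fin d → ℝ) (s : ℝ) (T r k t : ℕ) (hr : r < T) (h1 : 1 ≤ t)
    (h2 : t < T) (j : Fin d) : resWt f s T r (r + k * T + t) j = 1 := by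
  unfold resWt
  rw [if_neg]
  intro h
  rw [show r + k * T + t = r + t + T * k by ring, Nat.add_mul_mod_self_left] at h
  rcases lt_or_ge (r + t) T with h3 | h3
  · rw [Nat.mod_eq_of_lt h3] at h; omega
  · rw [Nat.mod_eq_sub_mod h3, Nat.mod_eq_of_lt (by omega)] at h; omega

lemma resWt_eq {d : ℕ} (f : Fin d → ℝ) (s : ℝ) (T r k : ℕ) (hr : r < T)
    (j : Fin d) : resWt f s T r (r + k * T) j = Real.exp (s * f j) := by
  unfold resWt
  rw [if_pos]
  rw [Nat.add_mul_mod_self_right, Nat.mod_eq_of_lt hr]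

lemma remVal_init {d : ℕ} {P : Matrix (Fin d) (Fin d) ℝ} (hP : IsTransMat P)
    (f : Fin d → ℝ) (s : ℝ) (T r : ℕ) (hr : r < T) (n : ℕ) (hn : n ≤ r) (i : Fin d) :
    remVal P (resWt f s T r) n i = 1 := by
  induction n generalizing i with
  | zero => rfl
  | succ n ih =>
    have h : ∀ j, resWt f s T r n j = 1 := fun j => by
      unfold resWt
      rw [if_neg]
      rw [Nat.mod_eq_of_lt (by omega)]; omega
    simp only [remVal, h, ih (by omega), Matrix.mulVec, dotProduct, mul_one, hP.2]

lemma remVal_block {d : ℕ} {P : Matrix (Fin d) (Fin d) ℝ} (hP : IsTransMat P)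
    (f : Fin d → ℝ) (s B : ℝ) (hB : 0 ≤ B) (T r : ℕ) (hr : r < T)
    (hTB : ∀ i, ∑ j, (P ^ T) i j * Real.exp (s * f j) ≤ B) (k : ℕ) :
    ∀ i, remVal P (resWt f s T r) (r + k * T) i ≤ B ^ k := by
  induction k with
  | zero => intro i; simp [remVal_init hP f s T r hr r le_rfl]
  | succ k ih =>
    intro i
    obtain ⟨T', rfl⟩ : ∃ T', T = T' + 1 := ⟨T - 1, by omega⟩
    have h := remVal_skip P (resWt f s (T' + 1) r) (r + k * (T' + 1)) T'
      (fun t h1 h2 j => resWt_ne f s _ r k t hr h1 (by omega) j)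
    rw [show r + (k + 1) * (T' + 1) = r + k * (T' + 1) + T' + 1 by ring, h]
    simp only [resWt_eq f s (T' + 1) r k hr]
    calc _ ≤ (P ^ (T' + 1)).mulVec (fun j => Real.exp (s * f j) * B ^ k) i :=
          mulVec_mono (transMat_pow hP _)
            (fun j => mul_le_mul_of_nonneg_left (ih j) (Real.exp_pos _).le) i
      _ = (∑ j, (P ^ (T' + 1)) i j * Real.exp (s * f j)) * B ^ k := by
          simp only [Matrix.mulVec, dotProduct, Finset.sum_mul, mul_assoc]
      _ ≤ B * B ^ k := mul_le_mul_of_nonneg_right (hTB i) (pow_nonneg hB _)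
      _ = _ := by ring

lemma remVal_total {d : ℕ} {P : Matrix (Fin d) (Fin d) ℝ} (hP : IsTransMat P)
    (π₀ f : Fin d → ℝ) (hπ₀ : IsProbVec π₀) (s B : ℝ) (hB : 0 ≤ B) (T r : ℕ) (hr : r < T)
    (hTB : ∀ i, ∑ j, (P ^ T) i j * Real.exp (s * f j) ≤ B)
    (h0 : ∀ t, 1 ≤ t → t ≤ T → ∑ j, (Matrix.vecMul π₀ (P ^ t)) j * Real.exp (s * f j) ≤ B)
    (m : ℕ) :
    ∑ i, π₀ i * remVal P (resWt f s T r) ((m + 1) * T) i ≤ B ^ (m + 1) := by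
  obtain ⟨k, rfl⟩ : ∃ k, T = r + k + 1 := ⟨T - r - 1, by omega⟩
  have h := remVal_skip P (resWt f s (r + k + 1) r) (r + m * (r + k + 1)) k
    (fun t h1 h2 j => resWt_ne f s _ r m t hr h1 (by omega) j)
  rw [show (m + 1) * (r + k + 1) = r + m * (r + k + 1) + k + 1 by ring, h]
  simp only [resWt_eq f s _ r m hr]
  have hb := remVal_block hP f s B hB _ r hr hTB m
  calc _ ≤ ∑ i, π₀ i * (P ^ (k + 1)).mulVec (fun j => Real.exp (s * f j) * B ^ m) i :=
        Finset.sum_le_sum fun i _ => mul_le_mul_of_nonneg_left (mulVec_mono (transMat_pow hP _)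
          (fun j => mul_le_mul_of_nonneg_left (hb j) (Real.exp_pos _).le) i) (hπ₀.1 i)
    _ = (∑ j, (Matrix.vecMul π₀ (P ^ (k + 1))) j * Real.exp (s * f j)) * B ^ m := by
        simp only [Matrix.mulVec, Matrix.vecMul, dotProduct, Finset.sum_mul, Finset.mul_sum]
        rw [Finset.sum_comm]
        refine Finset.sum_congr rfl fun i _ => Finset.sum_congr rfl fun j _ => ?_
        ring
    _ ≤ B * B ^ m := mul_le_mul_of_nonneg_right (h0 _ (by omega) (by omega)) (pow_nonneg hB _)
    _ = _ := by ring

lemma hoeffding_T {d : ℕ} {P : Matrix (Fin d) (Fin d) ℝ} (hP : IsTransMat P)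
    (π π₀ f : Fin d → ℝ) (hπ₀ : IsProbVec π₀)
    (hf : ∀ i, f i ∈ Set.Icc (0 : ℝ) 1) (μ : ℝ) (hμ : μ = ∑ i, π i * f i)
    (ε : ℝ) (hε : 0 < ε) (T : ℕ) (hT : 1 ≤ T)
    (hmix : ∀ i, fDisc f (fun j => (P ^ T) i j) π ≤ ε / 2)
    (hinit : ∀ t < T, fDisc f (Matrix.vecMul π₀ (P ^ t)) π ≤ ε / 2)
    (N : ℕ) (hN : 0 < N) (hdvd : T ∣ N) :
    pathProb P π₀ N (fun x => μ + ε ≤ (1 / (N : ℝ)) * ∑ n : Fin N, f (x n.succ)) ≤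
        Real.exp (-(ε ^ 2 * (N : ℝ)) / (8 * T)) := by
  obtain ⟨m', hm'⟩ := hdvd
  obtain ⟨m, rfl⟩ : ∃ m, m' = m + 1 := ⟨m' - 1, by
    have : m' ≠ 0 := by rintro rfl; omega
    omega⟩
  set s := ε / 2 with hs
  have hs0 : 0 < s := by positivity
  set B := Real.exp (s * (μ + ε / 2) + s ^ 2 / 2) with hBdef
  have hB : 0 ≤ B := (Real.exp_pos _).le
  have hTB1 : ∀ i, ∑ j, (P ^ T) i j * f j ≤ μ + ε / 2 := fun i => by
    have := (abs_le.1 (hmix i)).2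
    rw [← hμ] at this; linarith
  have hTB : ∀ i, ∑ j, (P ^ T) i j * Real.exp (s * f j) ≤ B := fun i =>
    mgf_bound _ f ⟨(transMat_pow hP T).1 i, (transMat_pow hP T).2 i⟩ hf s _ hs0.le (hTB1 i)
  have hpv : ∀ t, IsProbVec (Matrix.vecMul π₀ (P ^ t)) := fun t => by
    simp only [IsProbVec, Matrix.vecMul, dotProduct]
    refine ⟨fun j => Finset.sum_nonneg fun i _ =>
      mul_nonneg (hπ₀.1 i) ((transMat_pow hP t).1 i j), ?_⟩
    rw [Finset.sum_comm]
    simp only [← Finset.mul_sum, (transMat_pow hP t).2, mul_one, hπ₀.2]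
  have h0 : ∀ t, 1 ≤ t → t ≤ T →
      ∑ j, (Matrix.vecMul π₀ (P ^ t)) j * Real.exp (s * f j) ≤ B := by
    intro t h1 h2
    refine mgf_bound _ f (hpv t) hf s _ hs0.le ?_
    rcases lt_or_eq_of_le h2 with h3 | rfl
    · have := (abs_le.1 (hinit t h3)).2
      rw [← hμ] at this; linarith
    · calc _ = ∑ i, π₀ i * ∑ j, (P ^ t) i j * f j := by
            simp only [Matrix.vecMul, dotProduct, Finset.sum_mul, Finset.mul_sum]
            rw [Finset.sum_comm]
            simp only [mul_assoc]
        _ ≤ ∑ i, π₀ i * (μ + ε / 2) :=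
            Finset.sum_le_sum fun i _ => mul_le_mul_of_nonneg_left (hTB1 i) (hπ₀.1 i)
        _ = _ := by rw [← Finset.sum_mul, hπ₀.2, one_mul]
  have hE : ∀ r ∈ Finset.range T, pathExp P π₀ N
      (fun x => ∏ n : Fin N, resWt f s T r (N - 1 - n) (x n.succ)) ≤ B ^ (m + 1) := by
    intro r hr
    rw [pathExp_prod, hm', mul_comm T]
    exact remVal_total hP π₀ f hπ₀ s B hB T r (Finset.mem_range.1 hr) hTB h0 m
  have hTpos : (0 : ℝ) < T := by exact_mod_cast hT
  have hNpos : (0 : ℝ) < N := by exact_mod_cast hN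
  have hNT : (N : ℝ) = T * (m + 1) := by rw [hm']; push_cast; ring
  set C := Real.exp (-(s * (m + 1) * (μ + ε))) with hC
  have hmass : ∀ x, 0 ≤ pathMass P π₀ N x := fun x =>
    mul_nonneg (hπ₀.1 _) (Finset.prod_nonneg fun n _ => hP.1 _ _)
  have hpt : ∀ x : Fin (N + 1) → Fin d,
      μ + ε ≤ (1 / (N : ℝ)) * ∑ n : Fin N, f (x n.succ) →
      1 ≤ C * ∑ r ∈ Finset.range T, (1 / (T : ℝ)) *
        ∏ n : Fin N, resWt f s T r (N - 1 - n) (x n.succ) := by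
    intro x hx
    have hprod : ∀ r, ∏ n : Fin N, resWt f s T r (N - 1 - n) (x n.succ) =
        Real.exp (∑ n : Fin N, if (N - 1 - (n : ℕ)) % T = r then s * f (x n.succ) else 0) := by
      intro r
      rw [Real.exp_sum]
      refine Finset.prod_congr rfl fun n _ => ?_
      unfold resWt
      split_ifs <;> simp
    have hj := convexOn_exp.map_sum_le (t := Finset.range T) (w := fun _ => 1 / (T : ℝ))
      (p := fun r => ∑ n : Fin N, if (N - 1 - (n : ℕ)) % T = r then s * f (x n.succ) else 0)
      (fun _ _ => by positivity) (by simp; field_simp) (fun _ _ => Set.mem_univ _)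
    simp only [smul_eq_mul] at hj
    simp only [hprod]
    have hsum : ∑ r ∈ Finset.range T, 1 / (T : ℝ) *
        (∑ n : Fin N, if (N - 1 - (n : ℕ)) % T = r then s * f (x n.succ) else 0) =
        1 / T * (s * ∑ n : Fin N, f (x n.succ)) := by
      rw [← Finset.mul_sum, Finset.sum_comm]
      congr 1
      rw [Finset.mul_sum]
      refine Finset.sum_congr rfl fun n _ => ?_
      rw [Finset.sum_ite_eq, if_pos (Finset.mem_range.2 (Nat.mod_lt _ (by omega)))]
    rw [hsum] at hj
    refine le_trans ?_ (mul_le_mul_of_nonneg_left hj (Real.exp_pos _).le)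
    rw [hC, ← Real.exp_add, Real.one_le_exp_iff]
    have h3 : (N : ℝ) * (μ + ε) ≤ ∑ n : Fin N, f (x n.succ) := by
      rw [one_div, inv_mul_eq_div, le_div_iff₀ hNpos] at hx
      linarith
    have h4 : (m + 1 : ℝ) * (μ + ε) ≤ 1 / T * ∑ n : Fin N, f (x n.succ) := by
      rw [one_div, inv_mul_eq_div, le_div_iff₀ hTpos]
      rw [hNT] at h3; linarith
    have h5 := mul_le_mul_of_nonneg_left h4 hs0.le
    have h6 : 1 / (T : ℝ) * (s * ∑ n : Fin N, f (x n.succ)) =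
      s * (1 / T * ∑ n : Fin N, f (x n.succ)) := by ring
    rw [h6]; linarith
  have hmain : pathProb P π₀ N (fun x => μ + ε ≤ (1 / (N : ℝ)) * ∑ n : Fin N, f (x n.succ)) ≤
      C * ∑ r ∈ Finset.range T, (1 / (T : ℝ)) *
        pathExp P π₀ N (fun x => ∏ n : Fin N, resWt f s T r (N - 1 - n) (x n.succ)) := by
    have : C * ∑ r ∈ Finset.range T, (1 / (T : ℝ)) *
        pathExp P π₀ N (fun x => ∏ n : Fin N, resWt f s T r (N - 1 - n) (x n.succ)) =
        ∑ x : Fin (N + 1) → Fin d, pathMass P π₀ N x * (C * ∑ r ∈ Finset.range T, (1 / (T : ℝ)) *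
        ∏ n : Fin N, resWt f s T r (N - 1 - n) (x n.succ)) := by
      simp only [pathExp, Finset.mul_sum]
      rw [Finset.sum_comm]
      refine Finset.sum_congr rfl fun i _ => Finset.sum_congr rfl fun j _ => ?_
      ring
    rw [this]
    unfold pathProb
    refine Finset.sum_le_sum fun x _ => ?_
    split_ifs with hx
    · exact le_mul_of_one_le_right (hmass x) (hpt x hx)
    · refine mul_nonneg (hmass x) (mul_nonneg (Real.exp_pos _).le (Finset.sum_nonneg fun r _ =>
        mul_nonneg (by positivity) (Finset.prod_nonneg fun n _ => ?_)))
      unfold resWt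
      split_ifs
      · exact (Real.exp_pos _).le
      · norm_num
  refine hmain.trans ?_
  calc _ ≤ C * ∑ r ∈ Finset.range T, (1 / (T : ℝ)) * B ^ (m + 1) :=
        mul_le_mul_of_nonneg_left (Finset.sum_le_sum fun r hr =>
          mul_le_mul_of_nonneg_left (hE r hr) (by positivity)) (Real.exp_pos _).le
    _ = C * B ^ (m + 1) := by
        rw [Finset.sum_const, Finset.card_range, nsmul_eq_mul]; field_simp
    _ = _ := by
        rw [hC, hBdef, ← Real.exp_nat_mul, ← Real.exp_add]
        congr 1
        rw [hNT, hs]; push_cast; field_simp; ring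

lemma spectral_disc
    {d : ℕ} (hd : 0 < d)
    (P : Matrix (Fin d) (Fin d) ℝ) (π f : Fin d → ℝ)
    (hπ : IsStationaryDist P π)
    (hf : ∀ i, f i ∈ Set.Icc (0 : ℝ) 1)
    (πmin : ℝ) (hπmin : ∀ i, πmin ≤ π i) (hpos : 0 < πmin)
    (A : Matrix (Fin d) (Fin d) ℝ)
    (hA : ∀ i j, A i j = Real.sqrt (π i) * P i j / Real.sqrt (π j))
    (lam : Fin d → ℝ) (γ : Fin d → Fin d → ℝ)
    (horth : ∀ j k, ∑ i, γ j i * γ k i = if j = k then (1 : ℝ) else 0)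
    (heig : ∀ j, A.mulVec (γ j) = lam j • γ j)
    (hlam0 : lam ⟨0, hd⟩ = 1)
    (hγ0 : ∀ i, γ ⟨0, hd⟩ i = Real.sqrt (π i))
    (lamf : ℝ) (hlf0 : 0 ≤ lamf)
    (hlamf : ∀ j, j ≠ ⟨0, hd⟩ → ∑ i, Real.sqrt (π i) * γ j i * f i ≠ 0 → |lam j| ≤ lamf)
    (n : ℕ) (i : Fin d) :
    fDisc f (fun j => (P ^ n) i j) π ≤ lamf ^ n / Real.sqrt πmin := by
  have hsp : ∀ i, 0 < Real.sqrt (π i) := fun i => Real.sqrt_pos.2 (hπ.1 i)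
  have hcomp : ∀ i j, ∑ k, γ k i * γ k j = if i = j then (1 : ℝ) else 0 := by
    have h1 : (Matrix.of γ) * (Matrix.of γ).transpose = 1 := by
      ext j k
      simp [Matrix.mul_apply, Matrix.one_apply, horth]
    have h2 := mul_eq_one_comm.1 h1
    intro i j
    have := congrFun (congrFun h2 i) j
    simpa [Matrix.mul_apply, Matrix.one_apply] using this
  set a : Fin d → ℝ := fun k => ∑ i, Real.sqrt (π i) * γ k i * f i with ha
  have hexp : ∀ i, ∑ k, a k * γ k i = Real.sqrt (π i) * f i := by
    intro i
    simp only [ha, Finset.sum_mul]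
    rw [Finset.sum_comm]
    calc _ = ∑ j, Real.sqrt (π j) * f j * ∑ k, γ k j * γ k i := by
          refine Finset.sum_congr rfl fun j _ => ?_
          rw [Finset.mul_sum]
          exact Finset.sum_congr rfl fun k _ => by ring
      _ = _ := by simp [hcomp]
  have hpars : ∑ k, a k ^ 2 ≤ 1 := by
    calc ∑ k, a k ^ 2 = ∑ k, ∑ i, Real.sqrt (π i) * f i * (a k * γ k i) := by
          refine Finset.sum_congr rfl fun k _ => ?_
          rw [sq]
          nth_rw 2 [ha]
          simp only [Finset.mul_sum]
          exact Finset.sum_congr rfl fun k _ => by ring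
      _ = ∑ i, Real.sqrt (π i) * f i * (Real.sqrt (π i) * f i) := by
          rw [Finset.sum_comm]
          simp only [← Finset.mul_sum, hexp]
      _ = ∑ i, π i * f i ^ 2 := by
          refine Finset.sum_congr rfl fun k _ => ?_
          nth_rw 3 [← Real.mul_self_sqrt (hπ.1 k).le]; ring
      _ ≤ ∑ i, π i := Finset.sum_le_sum fun i _ =>
          mul_le_of_le_one_right (hπ.1 i).le (pow_le_one₀ (hf i).1 (hf i).2)
      _ = 1 := hπ.2.1
  have hev : ∀ n : ℕ, ∀ i, Real.sqrt (π i) * (P ^ n).mulVec f i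
      = ∑ k, a k * lam k ^ n * γ k i := by
    intro n
    induction n with
    | zero => intro i; simp [hexp]
    | succ n ih =>
      intro i
      rw [pow_succ', ← Matrix.mulVec_mulVec]
      calc _ = ∑ j, A i j * (Real.sqrt (π j) * (P ^ n).mulVec f j) := by
            rw [Matrix.mulVec, dotProduct, Finset.mul_sum]
            refine Finset.sum_congr rfl fun j _ => ?_
            rw [hA]
            have := (hsp j).ne'
            field_simp
        _ = ∑ k, a k * lam k ^ n * A.mulVec (γ k) i := by
            simp only [ih]
            simp only [Matrix.mulVec, dotProduct, Finset.mul_sum]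
            rw [Finset.sum_comm]
            refine Finset.sum_congr rfl fun j _ => Finset.sum_congr rfl fun k _ => ?_
            ring
        _ = _ := by
            simp only [heig, Pi.smul_apply, smul_eq_mul]
            exact Finset.sum_congr rfl fun j _ => by ring
  have ha0 : a ⟨0, hd⟩ = ∑ i, π i * f i := by
    simp only [ha, hγ0]
    exact Finset.sum_congr rfl fun j _ => by rw [Real.mul_self_sqrt (hπ.1 j).le]
  have hdiff : Real.sqrt (π i) * (∑ j, (P ^ n) i j * f j - ∑ j, π j * f j) =
      ∑ k ∈ Finset.univ.erase ⟨0, hd⟩, a k * lam k ^ n * γ k i := by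
    have h1 := hev n i
    rw [← Finset.add_sum_erase _ _ (Finset.mem_univ (⟨0, hd⟩ : Fin d)), hlam0, hγ0, ha0] at h1
    simp only [Matrix.mulVec, dotProduct] at h1
    rw [mul_sub, h1]; ring
  have hbd : Real.sqrt (π i) * fDisc f (fun j => (P ^ n) i j) π ≤ lamf ^ n := by
    have habs : Real.sqrt (π i) * fDisc f (fun j => (P ^ n) i j) π =
        |Real.sqrt (π i) * (∑ j, (P ^ n) i j * f j - ∑ j, π j * f j)| := by
      rw [abs_mul, abs_of_pos (hsp i)]
      rfl
    rw [habs, hdiff]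
    calc _ ≤ ∑ k ∈ Finset.univ.erase ⟨0, hd⟩, |a k * lam k ^ n * γ k i| :=
          Finset.abs_sum_le_sum_abs _ _
      _ ≤ ∑ k ∈ Finset.univ.erase ⟨0, hd⟩, lamf ^ n * ((a k ^ 2 + γ k i * γ k i) / 2) := by
          refine Finset.sum_le_sum fun k hk => ?_
          have hnn : 0 ≤ (a k ^ 2 + γ k i * γ k i) / 2 := by nlinarith [sq_nonneg (a k), mul_self_nonneg (γ k i)]
          by_cases h0 : a k = 0
          · rw [h0] at hnn ⊢
            simp only [zero_mul, abs_zero]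
            exact mul_nonneg (pow_nonneg hlf0 n) hnn
          · have h1 := hlamf k (Finset.ne_of_mem_erase hk) h0
            rw [abs_mul, abs_mul, abs_pow]
            have h2 : |lam k| ^ n ≤ lamf ^ n := pow_le_pow_left₀ (abs_nonneg _) h1 n
            have h3 : |a k| * |γ k i| ≤ (a k ^ 2 + γ k i * γ k i) / 2 := by
              rw [← sq_abs (a k), ← abs_mul_abs_self (γ k i)]
              nlinarith [sq_nonneg (|a k| - |γ k i|)]
            calc _ = |lam k| ^ n * (|a k| * |γ k i|) := by ring
              _ ≤ _ := mul_le_mul h2 h3 (by positivity) (pow_nonneg hlf0 n)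
      _ ≤ ∑ k, lamf ^ n * ((a k ^ 2 + γ k i * γ k i) / 2) :=
          Finset.sum_le_sum_of_subset_of_nonneg (Finset.erase_subset _ _) fun k _ _ =>
            mul_nonneg (pow_nonneg hlf0 n) (by nlinarith [sq_nonneg (a k), mul_self_nonneg (γ k i)])
      _ = lamf ^ n * ((∑ k, a k ^ 2 + 1) / 2) := by
          rw [← Finset.mul_sum, ← Finset.sum_div, Finset.sum_add_distrib, hcomp, if_pos rfl]
      _ ≤ lamf ^ n := mul_le_of_le_one_right (pow_nonneg hlf0 n) (by linarith)
  rw [le_div_iff₀ (Real.sqrt_pos.2 hpos), mul_comm]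
  exact (mul_le_mul_of_nonneg_right (Real.sqrt_le_sqrt (hπmin i)) (abs_nonneg _)).trans hbd

/-- spectral Hoeffding bound (Corollary `cor:hoeffding-derived-eps2`). -/
theorem hoeffding_spectral_bound
    {d : ℕ} (hd : 0 < d)
    (P : Matrix (Fin d) (Fin d) ℝ) (π π₀ f : Fin d → ℝ)
    (hP : IsTransMat P) (hirr : IsIrreducibleMat P) (haper : IsAperiodicMat P)
    (hπ : IsStationaryDist P π) (hrev : IsReversibleMat P π) (hπ₀ : IsProbVec π₀)
    (hf : ∀ i, f i ∈ Set.Icc (0 : ℝ) 1)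
    (μ : ℝ) (hμ : μ = ∑ i, π i * f i)
    (πmin : ℝ) (hπmin : πmin = Finset.univ.inf' ⟨⟨0, hd⟩, Finset.mem_univ _⟩ π)
    (A : Matrix (Fin d) (Fin d) ℝ)
    (hA : ∀ i j, A i j = Real.sqrt (π i) * P i j / Real.sqrt (π j))
    (lam : Fin d → ℝ) (γ : Fin d → Fin d → ℝ)
    (horth : ∀ j k, ∑ i, γ j i * γ k i = if j = k then (1 : ℝ) else 0)
    (heig : ∀ j, A.mulVec (γ j) = lam j • γ j)
    (hlam0 : lam ⟨0, hd⟩ = 1) (hmono : ∀ j k : Fin d, j ≤ k → lam k ≤ lam j)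
    (hlt1 : ∀ j : Fin d, j ≠ ⟨0, hd⟩ → lam j < 1) (hgtm1 : ∀ j, (-1 : ℝ) < lam j)
    (hγ0 : ∀ i, γ ⟨0, hd⟩ i = Real.sqrt (π i))
    (q : Fin d → Fin d → ℝ) (hq : ∀ j i, q j i = Real.sqrt (π i) * γ j i)
    (Jf : Finset (Fin d))
    (hJf : ∀ j, j ∈ Jf ↔ (j ≠ ⟨0, hd⟩ ∧ ∑ i, q j i * f i ≠ 0))
    (lamf : ℝ)
    (hlamf : lamf = if hne : Jf.Nonempty then Jf.sup' hne (fun j => |lam j|) else 0)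
    (ε : ℝ) (hε : ε ∈ Set.Ioo (0 : ℝ) 1)
    (T : ℕ) (hT : T = fMixTime P π f (ε / 2))
    (hinit : ∀ t < T, fDisc f (Matrix.vecMul π₀ (P ^ t)) π ≤ ε / 2)
    (N : ℕ) (hN : 0 < N) (hdvd : T ∣ N) :
    (2 * lamf / Real.sqrt πmin < ε →
      T = 1 ∧
      pathProb P π₀ N (fun x => μ + ε ≤ (1 / (N : ℝ)) * ∑ n : Fin N, f (x n.succ)) ≤
        Real.exp (-(ε ^ 2 * (N : ℝ)) / 8)) ∧
    (ε ≤ 2 * lamf / Real.sqrt πmin →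
      T ≤ ⌈Real.log (2 / (ε * Real.sqrt πmin)) / Real.log (1 / lamf)⌉₊ ∧
      pathProb P π₀ N (fun x => μ + ε ≤ (1 / (N : ℝ)) * ∑ n : Fin N, f (x n.succ)) ≤
        Real.exp (-(ε ^ 2 * (N : ℝ)) /
          (8 * (⌈Real.log (2 / (ε * Real.sqrt πmin)) / Real.log (1 / lamf)⌉₊ : ℝ)))) := by
  obtain ⟨hε0, hε1⟩ := hε
  have hmin : ∀ i, πmin ≤ π i := fun i => by
    rw [hπmin]; exact Finset.inf'_le _ (Finset.mem_univ i)
  have hpos : 0 < πmin := by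
    obtain ⟨i, _, hi⟩ := Finset.exists_mem_eq_inf' (s := Finset.univ)
      ⟨⟨0, hd⟩, Finset.mem_univ _⟩ π
    rw [hπmin]
    exact lt_of_lt_of_eq (hπ.1 i) hi.symm
  have hle1 : πmin ≤ 1 := (hmin ⟨0, hd⟩).trans (by
    rw [← hπ.2.1]
    exact Finset.single_le_sum (fun i _ => (hπ.1 i).le) (Finset.mem_univ _))
  have hlf : ∀ j ∈ Jf, |lam j| ≤ lamf := fun j hj => by
    rw [hlamf, dif_pos ⟨j, hj⟩]
    exact Finset.le_sup' (fun j => |lam j|) hj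
  have hlf0 : 0 ≤ lamf := by
    by_cases hne : Jf.Nonempty
    · obtain ⟨j, hj⟩ := hne
      exact (abs_nonneg _).trans (hlf j hj)
    · rw [hlamf, dif_neg hne]
  have hlf1 : lamf < 1 := by
    rw [hlamf]
    split_ifs with hne
    · rw [Finset.sup'_lt_iff]
      intro j hj
      exact abs_lt.2 ⟨hgtm1 j, hlt1 j ((hJf j).1 hj).1⟩
    · norm_num
  have hdisc : ∀ n i, fDisc f (fun j => (P ^ n) i j) π ≤ lamf ^ n / Real.sqrt πmin :=
    fun n i => spectral_disc hd P π f hπ hf πmin hmin hpos A hA lam γ horth heig hlam0 hγ0 lamf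
      hlf0 (fun j hj h => hlf j ((hJf j).2 ⟨hj, by simpa only [hq] using h⟩)) n i
  have hsq : 0 < Real.sqrt πmin := Real.sqrt_pos.2 hpos
  have hsq1 : Real.sqrt πmin ≤ 1 := Real.sqrt_le_one.2 hle1
  have hfin : ∀ c : ℕ, 1 ≤ c → lamf ^ c / Real.sqrt πmin ≤ ε / 2 → 1 ≤ T ∧ T ≤ c ∧
      pathProb P π₀ N (fun x => μ + ε ≤ (1 / (N : ℝ)) * ∑ n : Fin N, f (x n.succ)) ≤
        Real.exp (-(ε ^ 2 * (N : ℝ)) / (8 * (c : ℝ))) := by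
    intro c hc1 hc
    have hmem : c ∈ {n : ℕ | 1 ≤ n ∧ ∀ i, fDisc f (fun j => (P ^ n) i j) π ≤ ε / 2} :=
      ⟨hc1, fun i => (hdisc c i).trans hc⟩
    have hTm := Nat.sInf_mem ⟨c, hmem⟩
    have hTc := Nat.sInf_le hmem
    unfold fMixTime at hT
    rw [← hT] at hTm hTc
    refine ⟨hTm.1, hTc, (hoeffding_T hP π π₀ f hπ₀ hf μ hμ ε hε0 T hTm.1 hTm.2 hinit N hN
      hdvd).trans (Real.exp_le_exp.2 ?_)⟩
    have h1 : (0 : ℝ) < T := by exact_mod_cast hTm.1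
    have h2 : (T : ℝ) ≤ c := by exact_mod_cast hTc
    rw [neg_div, neg_div, neg_le_neg_iff]
    exact div_le_div_of_nonneg_left (by positivity) (by positivity) (by linarith)
  constructor
  · intro h
    obtain ⟨h1, h2, h3⟩ := hfin 1 le_rfl (by
      rw [pow_one]
      have : 2 * lamf / Real.sqrt πmin = 2 * (lamf / Real.sqrt πmin) := by ring
      linarith)
    exact ⟨by omega, by simpa using h3⟩
  · intro h
    have hl0 : 0 < lamf := by
      rcases hlf0.lt_or_eq with h1 | h1
      · exact h1
      · rw [← h1] at h; simp at h; linarith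
    have hlog : 0 < Real.log (1 / lamf) := Real.log_pos (by rw [lt_div_iff₀ hl0]; linarith)
    have hprod : ε * Real.sqrt πmin < 1 := by nlinarith
    have hprod0 : 0 < ε * Real.sqrt πmin := by positivity
    have hlog2 : 0 < Real.log (2 / (ε * Real.sqrt πmin)) :=
      Real.log_pos (by rw [lt_div_iff₀ hprod0]; linarith)
    set c := ⌈Real.log (2 / (ε * Real.sqrt πmin)) / Real.log (1 / lamf)⌉₊ with hc
    have hc1 : 1 ≤ c := Nat.ceil_pos.2 (div_pos hlog2 hlog)
    have hcle : Real.log (2 / (ε * Real.sqrt πmin)) ≤ c * Real.log (1 / lamf) :=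
      (div_le_iff₀ hlog).1 (Nat.le_ceil _)
    have hpow : 2 / (ε * Real.sqrt πmin) ≤ (1 / lamf) ^ c := by
      rw [← Real.log_pow] at hcle
      exact (Real.log_le_log_iff (by positivity) (by positivity)).1 hcle
    obtain ⟨h1, h2, h3⟩ := hfin c hc1 (by
      rw [div_le_iff₀ hsq]
      rw [one_div, inv_pow, div_le_iff₀ hprod0, inv_mul_eq_div, le_div_iff₀ (by positivity)] at hpow
      linarith)
    exact ⟨h2, h3⟩
end

section
/- Fix α ∈ (0, 2/5], ξ ∈ (0, 2/5], r ∈ (0,1), and δ > 0, and start the chain from the stationary distribution (π₀ = π). Set M := 8 · T_f(δ/2) · log( 2/√(α·ξ) ) / δ, N₀ := ⌊ M · min(1/r, 1/(1−r)) ⌋, and N_k := ⌊ N₀ · (1+ξ)^k ⌋ for k ≥ 1. Assume that N_k ≥ 1 and N_{k+1} > N_k for all k ≥ 1, and that for each k ≥ 1 the integer T_f( (δ + M/N_k)/2 ) divides N_k. If μ ≤ r − δ, then for every K ≥ 1, P( ∃ k ∈ {1,…,K} : (1/N_k)·∑_{n=1}^{N_k} f(X_n) ≥ r + M/N_k ) ≤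 α. (Symmetrically, if μ ≥ r + δ, then for every K ≥ 1, P( ∃ k ∈ {1,…,K} : (1/N_k)·∑_{n=1}^{N_k} f(X_n) ≤ r − M/N_k ) ≤ α.) -/
open Finset

namespace SeqTest

/-- Hoeffding's lemma for a finite probability vector. -/
lemma hoeffding_fin {d : ℕ} (p g : Fin d → ℝ) (hp0 : ∀ i, 0 ≤ p i) (hp1 : ∑ i, p i = 1)
    (hg : ∀ i, g i ∈ Set.Icc (0 : ℝ) 1) (s b : ℝ) (hs : 0 ≤ s) (hb : ∑ i, p i * g i ≤ b) :
    ∑ i, p i * Real.exp (s * g i) ≤ Real.exp (s * b + s ^ 2 / 8) := by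
  have hsum : ∑ i, ENNReal.ofReal (p i) = 1 := by
    rw [← ENNReal.ofReal_sum_of_nonneg (fun i _ => hp0 i), hp1, ENNReal.ofReal_one]
  let q : PMF (Fin d) := PMF.ofFintype (fun i => ENNReal.ofReal (p i)) hsum
  have hint : ∀ h : Fin d → ℝ, ∫ a, h a ∂(q.toMeasure) = ∑ i, p i * h i := by
    intro h
    rw [PMF.integral_eq_sum]
    refine Finset.sum_congr rfl fun i _ => ?_
    simp [q, ENNReal.toReal_ofReal (hp0 i)]
  have h := (ProbabilityTheory.hasSubgaussianMGF_of_mem_Icc (μ := q.toMeasure) (X := g)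
    (a := 0) (b := 1) (Measurable.of_discrete.aemeasurable)
    (Filter.Eventually.of_forall hg)).mgf_le s
  rw [ProbabilityTheory.mgf, hint, hint] at h
  set m := ∑ i, p i * g i with hm
  have e1 : ∑ i, p i * Real.exp (s * g i)
      = Real.exp (s * m) * ∑ i, p i * Real.exp (s * (g i - m)) := by
    rw [Finset.mul_sum]
    refine Finset.sum_congr rfl fun i _ => ?_
    rw [mul_left_comm, ← Real.exp_add]
    ring_nf
  rw [e1]
  calc _ ≤ Real.exp (s * m) * Real.exp (s ^ 2 / 8) := by
        gcongr
        refine h.trans (le_of_eq ?_)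
        congr 1
        simp
        ring
    _ = Real.exp (s * m + s ^ 2 / 8) := by rw [Real.exp_add]
    _ ≤ _ := by gcongr

/-- Forward (unnormalised) weighted marginals. -/
noncomputable def fwd {d : ℕ} (P : Matrix (Fin d) (Fin d) ℝ) (p : Fin d → ℝ)
    (h : ℕ → Fin d → ℝ) : ℕ → Fin d → ℝ
  | 0 => fun i => p i * h 0 i
  | n + 1 => fun j => (∑ i, fwd P p h n i * P i j) * h (n + 1) j

lemma fwd_succ {d : ℕ} (P : Matrix (Fin d) (Fin d) ℝ) (p : Fin d → ℝ)
    (h : ℕ → Fin d → ℝ) (n : ℕ) (j : Fin d) :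
    fwd P p h (n + 1) j = (∑ i, fwd P p h n i * P i j) * h (n + 1) j := rfl

lemma sum_path {d : ℕ} (P : Matrix (Fin d) (Fin d) ℝ) (p : Fin d → ℝ)
    (h : ℕ → Fin d → ℝ) (N : ℕ) (φ : Fin d → ℝ) :
    ∑ x : Fin (N + 1) → Fin d,
      pathMass P p N x * (∏ n : Fin (N + 1), h n (x n)) * φ (x (Fin.last N))
      = ∑ i, fwd P p h N i * φ i := by
  induction N generalizing φ with
  | zero =>
    rw [← (Equiv.funUnique (Fin 1) (Fin d)).symm.sum_comp]
    simp [pathMass, fwd]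
  | succ N ih =>
    rw [← (Fin.snocEquiv (fun _ => Fin d)).sum_comp, Fintype.sum_prod_type]
    refine Finset.sum_congr rfl fun j _ => ?_
    rw [fwd_succ, ← ih (fun i => P i j), Finset.sum_mul, Finset.sum_mul]
    refine Finset.sum_congr rfl fun x _ => ?_
    rw [Fin.prod_univ_castSucc]
    simp only [pathMass, Fin.snocEquiv, Equiv.coe_fn_mk]
    rw [Fin.prod_univ_castSucc]
    have h0 : (Fin.snoc (α := fun _ => Fin d) x j : Fin (N + 2) → Fin d) 0 = x 0 := by
      have := Fin.snoc_castSucc (α := fun _ => Fin d) j x 0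
      simpa using this
    have h1 : ∀ n : Fin N, (Fin.snoc (α := fun _ => Fin d) x j : Fin (N + 2) → Fin d)
        (n.castSucc.succ) = x n.succ := by
      intro n
      rw [Fin.succ_castSucc]
      exact Fin.snoc_castSucc (α := fun _ => Fin d) j x _
    simp only [Fin.snoc_castSucc, Fin.snoc_last, h0, h1, Fin.succ_last, Fin.val_castSucc,
      Fin.val_last]
    ring

lemma fwd_nonneg {d : ℕ} (P : Matrix (Fin d) (Fin d) ℝ) (p : Fin d → ℝ)
    (h : ℕ → Fin d → ℝ) (hP : ∀ i j, 0 ≤ P i j) (hp : ∀ i, 0 ≤ p i) (hh : ∀ n i, 0 ≤ h n i)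
    (n : ℕ) (i : Fin d) : 0 ≤ fwd P p h n i := by
  induction n generalizing i with
  | zero => exact mul_nonneg (hp i) (hh 0 i)
  | succ n ih =>
    exact mul_nonneg (Finset.sum_nonneg fun k _ => mul_nonneg (ih k) (hP k i)) (hh _ i)

/-- Unmarked steps. -/
lemma fwd_free {d : ℕ} (P : Matrix (Fin d) (Fin d) ℝ) (p : Fin d → ℝ)
    (h : ℕ → Fin d → ℝ) (n r : ℕ) (hh : ∀ k, 0 < k → k ≤ r → ∀ i, h (n + k) i = 1)
    (j : Fin d) : fwd P p h (n + r) j = ∑ i, fwd P p h n i * (P ^ r) i j := by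
  induction r generalizing j with
  | zero => simp [Matrix.one_apply]
  | succ r ih =>
    rw [← add_assoc, fwd_succ]
    have := hh (r + 1) (by omega) le_rfl j
    rw [← add_assoc] at this
    rw [this, mul_one, pow_succ]
    simp_rw [ih (fun k hk hk' => hh k hk (by omega)), Matrix.mul_apply, Finset.sum_mul,
      Finset.mul_sum]
    rw [Finset.sum_comm]
    simp_rw [mul_assoc]

lemma row_sum_pow {d : ℕ} {P : Matrix (Fin d) (Fin d) ℝ} (hP : IsTransMat P) (n : ℕ) (i : Fin d) :
    ∑ j, (P ^ n) i j = 1 := by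
  induction n generalizing i with
  | zero => simp [Matrix.one_apply]
  | succ n ih =>
    simp_rw [pow_succ, Matrix.mul_apply]
    rw [Finset.sum_comm]
    simp_rw [← Finset.mul_sum, hP.2, mul_one]
    exact ih i

lemma pow_nonneg' {d : ℕ} {P : Matrix (Fin d) (Fin d) ℝ} (hP : IsTransMat P) (n : ℕ)
    (i j : Fin d) : 0 ≤ (P ^ n) i j := by
  induction n generalizing i j with
  | zero =>
    rw [pow_zero, Matrix.one_apply]
    split_ifs <;> norm_num
  | succ n ih =>
    rw [pow_succ, Matrix.mul_apply]
    exact Finset.sum_nonneg fun k _ => mul_nonneg (ih i k) (hP.1 k j)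

lemma fwd_free_mass {d : ℕ} {P : Matrix (Fin d) (Fin d) ℝ} (hP : IsTransMat P) (p : Fin d → ℝ)
    (h : ℕ → Fin d → ℝ) (n r : ℕ) (hh : ∀ k, 0 < k → k ≤ r → ∀ i, h (n + k) i = 1) :
    ∑ j, fwd P p h (n + r) j = ∑ i, fwd P p h n i := by
  simp_rw [fwd_free P p h n r hh]
  rw [Finset.sum_comm]
  simp_rw [← Finset.mul_sum, row_sum_pow hP, mul_one]

/-- One block step. -/
lemma fwd_block {d : ℕ} {P : Matrix (Fin d) (Fin d) ℝ} (hP : IsTransMat P) (p : Fin d → ℝ)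
    (hp : ∀ i, 0 ≤ p i) (g : Fin d → ℝ) (hg : ∀ i, g i ∈ Set.Icc (0 : ℝ) 1)
    (h : ℕ → Fin d → ℝ) (hh0 : ∀ n i, 0 ≤ h n i) (s b : ℝ) (hs : 0 ≤ s) (n T : ℕ) (hT : 1 ≤ T)
    (hmix : ∀ i, ∑ j, (P ^ T) i j * g j ≤ b)
    (hh : ∀ k, 0 < k → k < T → ∀ i, h (n + k) i = 1)
    (hm : ∀ i, h (n + T) i = Real.exp (s * g i)) :
    ∑ j, fwd P p h (n + T) j ≤ (∑ i, fwd P p h n i) * Real.exp (s * b + s ^ 2 / 8) := by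
  obtain ⟨r, rfl⟩ : ∃ r, T = r + 1 := ⟨T - 1, by omega⟩
  have e : ∀ j, fwd P p h (n + (r + 1)) j
      = ∑ i, fwd P p h n i * ((P ^ (r + 1)) i j * Real.exp (s * g j)) := by
    intro j
    rw [← hm j, ← add_assoc, fwd_succ]
    simp_rw [fwd_free P p h n r (fun k hk hk' => hh k hk (by omega)), pow_succ P r,
      Matrix.mul_apply, Finset.sum_mul, Finset.mul_sum]
    rw [Finset.sum_comm]
    simp_rw [mul_assoc]
  simp_rw [e]
  rw [Finset.sum_comm, Finset.sum_mul]
  refine Finset.sum_le_sum fun i _ => ?_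
  rw [← Finset.mul_sum]
  exact mul_le_mul_of_nonneg_left (hoeffding_fin _ g (pow_nonneg' hP _ i) (row_sum_pow hP _ i) hg
    s b hs (hmix i)) (fwd_nonneg P p h hP.1 hp hh0 n i)

/-- Indicator that `n` lies in the block residue class `t`. -/
def mark (T m t n : ℕ) : Prop := (1 ≤ n ∧ n ≤ T * m) ∧ (n - 1) % T = t

instance (T m t n : ℕ) : Decidable (mark T m t n) := by unfold mark; infer_instance

lemma mark_yes {T m t j : ℕ} (ht : t < T) (hj : j < m) : mark T m t (t + 1 + j * T) := by
  refine ⟨⟨by omega, ?_⟩, ?_⟩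
  · have : (j + 1) * T ≤ m * T := Nat.mul_le_mul_right _ hj
    nlinarith
  · have : t + 1 + j * T - 1 = t + j * T := by omega
    rw [this, Nat.add_mul_mod_self_right, Nat.mod_eq_of_lt ht]

lemma mark_no {T m t j k : ℕ} (ht : t < T) (hk : 0 < k) (hkT : k < T) :
    ¬ mark T m t (t + 1 + j * T + k) := by
  rintro ⟨_, h⟩
  have : t + 1 + j * T + k - 1 = (t + k) + j * T := by omega
  rw [this, Nat.add_mul_mod_self_right] at h
  by_cases h1 : t + k < T
  · rw [Nat.mod_eq_of_lt h1] at h; omega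
  · rw [Nat.mod_eq_sub_mod (by omega), Nat.mod_eq_of_lt (by omega)] at h; omega

lemma mark_no_after {T m t k : ℕ} (ht : t < T) (hm : 1 ≤ m) (hk : 0 < k) :
    ¬ mark T m t (t + 1 + (m - 1) * T + k) := by
  intro h
  by_cases hkT : k < T
  · exact mark_no ht hk hkT h
  · obtain ⟨q, rfl⟩ : ∃ q, m = q + 1 := ⟨m - 1, by omega⟩
    have := h.1.2
    simp only [Nat.add_sub_cancel] at this
    nlinarith

lemma mark_no_before {T m t k : ℕ} (ht : t < T) (hk : k ≤ t) : ¬ mark T m t k := by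
  rintro ⟨⟨h1, _⟩, h⟩
  rw [Nat.mod_eq_of_lt (by omega)] at h
  omega

/-- Exponential moment of a residue class subsum. -/
lemma class_mgf {d : ℕ} {P : Matrix (Fin d) (Fin d) ℝ} (hP : IsTransMat P) {π : Fin d → ℝ}
    (hπ : IsStationaryDist P π) (g : Fin d → ℝ) (hg : ∀ i, g i ∈ Set.Icc (0 : ℝ) 1)
    (s b : ℝ) (hs : 0 ≤ s) (T m t N : ℕ) (ht : t < T) (hm : 1 ≤ m) (hN : T * m ≤ N)
    (hb : ∑ i, π i * g i ≤ b)
    (hmix : ∀ i, ∑ j, (P ^ T) i j * g j ≤ b) :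
    ∑ x : Fin (N + 1) → Fin d, pathMass P π N x *
      Real.exp (s * ∑ n : Fin (N + 1), if mark T m t n then g (x n) else 0)
      ≤ Real.exp (s * b + s ^ 2 / 8) ^ m := by
  set h : ℕ → Fin d → ℝ := fun n i => if mark T m t n then Real.exp (s * g i) else 1 with hh
  have hh0 : ∀ n i, 0 ≤ h n i := by
    intro n i
    simp only [hh]
    split_ifs
    · exact (Real.exp_pos _).le
    · norm_num
  have hyes : ∀ n i, mark T m t n → h n i = Real.exp (s * g i) := fun n i H => by simp [hh, H]
  have hno : ∀ n i, ¬ mark T m t n → h n i = 1 := fun n i H => by simp [hh, H]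
  have e1 : ∀ x : Fin (N + 1) → Fin d,
      Real.exp (s * ∑ n : Fin (N + 1), if mark T m t n then g (x n) else 0)
      = ∏ n : Fin (N + 1), h n (x n) := by
    intro x
    rw [Finset.mul_sum, Real.exp_sum]
    refine Finset.prod_congr rfl fun n _ => ?_
    simp only [hh]
    split_ifs <;> simp
  simp_rw [e1]
  have e2 := sum_path P π h N (fun _ => 1)
  simp only [mul_one] at e2
  rw [e2]
  have hbefore : ∀ k, k ≤ t → ∀ i, fwd P π h k i = π i := by
    intro k
    induction k with
    | zero => intro hk i; simp [fwd, hno _ _ (mark_no_before ht hk)]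
    | succ k ih =>
      intro hk i
      rw [fwd_succ, hno _ _ (mark_no_before ht hk), mul_one]
      simp_rw [ih (by omega)]
      exact hπ.2.2 i
  have hstep : ∀ j, j < m → ∑ i, fwd P π h (t + 1 + j * T) i
      ≤ Real.exp (s * b + s ^ 2 / 8) ^ (j + 1) := by
    intro j
    induction j with
    | zero =>
      intro hj
      have := mark_yes ht hj
      simp only [zero_mul, add_zero] at this ⊢
      simp_rw [fwd_succ, hyes _ _ this, hbefore t le_rfl, hπ.2.2]
      simpa using hoeffding_fin π g (fun i => (hπ.1 i).le) hπ.2.1 hg s b hs hb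
    | succ j ih =>
      intro hj
      have e3 : t + 1 + (j + 1) * T = t + 1 + j * T + T := by ring
      rw [e3, pow_succ]
      refine (fwd_block hP π (fun i => (hπ.1 i).le) g hg h hh0 s b hs _ T (by omega) hmix
        (fun k hk hk' i => hno _ _ (mark_no ht hk hk'))
        (fun i => hyes _ _ (by rw [← e3]; exact mark_yes ht hj))).trans ?_
      exact mul_le_mul_of_nonneg_right (ih (by omega)) (Real.exp_pos _).le
  have hlast := hstep (m - 1) (by omega)
  rw [Nat.sub_add_cancel hm] at hlast
  obtain ⟨r, hr⟩ : ∃ r, N = t + 1 + (m - 1) * T + r := by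
    refine ⟨N - (t + 1 + (m - 1) * T), ?_⟩
    have := (mark_yes (m := m) ht (j := m - 1) (by omega)).1.2
    omega
  have e4 := fwd_free_mass hP π h (t + 1 + (m - 1) * T) r
    (fun k hk _ i => hno _ _ (mark_no_after ht hm hk))
  rw [← hr] at e4
  rw [e4]
  exact hlast

lemma pathMass_nonneg {d : ℕ} {P : Matrix (Fin d) (Fin d) ℝ} (hP : IsTransMat P) {π : Fin d → ℝ}
    (hπ : ∀ i, 0 ≤ π i) (N : ℕ) (x : Fin (N + 1) → Fin d) : 0 ≤ pathMass P π N x :=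
  mul_nonneg (hπ _) (Finset.prod_nonneg fun _ _ => hP.1 _ _)

lemma conc {d : ℕ} {P : Matrix (Fin d) (Fin d) ℝ} (hP : IsTransMat P) {π : Fin d → ℝ}
    (hπ : IsStationaryDist P π) (g : Fin d → ℝ) (hg : ∀ i, g i ∈ Set.Icc (0 : ℝ) 1)
    (ν D : ℝ) (hν : ∑ i, π i * g i = ν) (hD : 0 ≤ D) (T m N : ℕ) (hT : 1 ≤ T) (hm : 1 ≤ m)
    (hN : T * m ≤ N)
    (hmix : ∀ i, ∑ j, (P ^ T) i j * g j ≤ ν + D / 2) :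
    pathProb P π N (fun x => ((T * m : ℕ) : ℝ) * (ν + D) ≤
      ∑ n : Fin (N + 1), if 1 ≤ (n : ℕ) ∧ (n : ℕ) ≤ T * m then g (x n) else 0)
      ≤ Real.exp (-(m * D ^ 2 / 2)) := by
  have hT0 : (0 : ℝ) < T := by exact_mod_cast hT
  have hpm := pathMass_nonneg hP (fun i => (hπ.1 i).le) N
  have hsplit : ∀ x : Fin (N + 1) → Fin d,
      (∑ n : Fin (N + 1), if 1 ≤ (n : ℕ) ∧ (n : ℕ) ≤ T * m then g (x n) else 0)
      = ∑ t ∈ range T, ∑ n : Fin (N + 1), if mark T m t n then g (x n) else 0 := by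
    intro x
    rw [Finset.sum_comm]
    refine Finset.sum_congr rfl fun n _ => ?_
    by_cases h : 1 ≤ (n : ℕ) ∧ (n : ℕ) ≤ T * m
    · simp [mark, h, Nat.mod_lt _ hT]
    · simp [mark, h]
  have hjen : ∀ x : Fin (N + 1) → Fin d,
      Real.exp (2 * D / T * ∑ n : Fin (N + 1),
        if 1 ≤ (n : ℕ) ∧ (n : ℕ) ≤ T * m then g (x n) else 0)
      ≤ ∑ t ∈ range T, (1 / (T : ℝ)) * Real.exp (2 * D *
          ∑ n : Fin (N + 1), if mark T m t n then g (x n) else 0) := by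
    intro x
    have := convexOn_exp.map_sum_le (t := range T) (w := fun _ => 1 / (T : ℝ))
      (p := fun t => 2 * D * ∑ n : Fin (N + 1), if mark T m t n then g (x n) else 0)
      (fun _ _ => by positivity) (by simp; field_simp) (fun _ _ => Set.mem_univ _)
    simp only [smul_eq_mul] at this
    refine le_trans (le_of_eq ?_) this
    rw [hsplit, Finset.mul_sum]
    congr 1
    refine Finset.sum_congr rfl fun t _ => ?_
    ring
  unfold pathProb
  calc _ ≤ ∑ x : Fin (N + 1) → Fin d, Real.exp (-(2 * D * m * (ν + D))) * ∑ t ∈ range T,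
        (1 / (T : ℝ)) * (pathMass P π N x * Real.exp (2 * D *
          ∑ n : Fin (N + 1), if mark T m t n then g (x n) else 0)) := by
        refine Finset.sum_le_sum fun x _ => ?_
        have e : Real.exp (-(2 * D * m * (ν + D))) * ∑ t ∈ range T,
          (1 / (T : ℝ)) * (pathMass P π N x * Real.exp (2 * D *
          ∑ n : Fin (N + 1), if mark T m t n then g (x n) else 0)) =
          pathMass P π N x * (Real.exp (-(2 * D * m * (ν + D))) * ∑ t ∈ range T,
          (1 / (T : ℝ)) * Real.exp (2 * D *
          ∑ n : Fin (N + 1), if mark T m t n then g (x n) else 0)) := by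
          simp_rw [Finset.mul_sum]
          refine Finset.sum_congr rfl fun t _ => ?_
          ring
        rw [e]
        split_ifs with hE
        · refine le_mul_of_one_le_right (hpm x) ?_
          refine le_trans ?_ (mul_le_mul_of_nonneg_left (hjen x) (Real.exp_pos _).le)
          rw [← Real.exp_add, Real.one_le_exp_iff]
          have := mul_le_mul_of_nonneg_left hE (show 0 ≤ 2 * D / T by positivity)
          have e5 : 2 * D / T * (((T * m : ℕ) : ℝ) * (ν + D)) = 2 * D * m * (ν + D) := by
            push_cast
            field_simp
          rw [e5] at this
          linarith
        · refine mul_nonneg (hpm x) (mul_nonneg (Real.exp_pos _).le ?_)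
          exact Finset.sum_nonneg fun t _ => by positivity
    _ = Real.exp (-(2 * D * m * (ν + D))) * ∑ t ∈ range T, (1 / (T : ℝ)) *
        ∑ x : Fin (N + 1) → Fin d, pathMass P π N x * Real.exp (2 * D *
          ∑ n : Fin (N + 1), if mark T m t n then g (x n) else 0) := by
        rw [← Finset.mul_sum, Finset.sum_comm]
        simp_rw [Finset.mul_sum]
    _ ≤ Real.exp (-(2 * D * m * (ν + D))) * ∑ t ∈ range T, (1 / (T : ℝ)) *
        Real.exp (2 * D * (ν + D / 2) + (2 * D) ^ 2 / 8) ^ m := by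
        refine mul_le_mul_of_nonneg_left (Finset.sum_le_sum fun t ht => ?_) (Real.exp_pos _).le
        refine mul_le_mul_of_nonneg_left ?_ (by positivity)
        exact class_mgf hP hπ g hg (2 * D) (ν + D / 2) (by positivity) T m t N
          (Finset.mem_range.mp ht) hm hN (by linarith) hmix
    _ = _ := by
        rw [Finset.sum_const, Finset.card_range, nsmul_eq_mul, ← mul_assoc (T : ℝ),
          mul_one_div_cancel hT0.ne', one_mul, ← Real.exp_nat_mul, ← Real.exp_add]
        congr 1
        ring

/-- Union bound. -/
lemma union_bound {d : ℕ} {P : Matrix (Fin d) (Fin d) ℝ} (hP : IsTransMat P) {π : Fin d → ℝ}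
    (hπ : ∀ i, 0 ≤ π i) (N K : ℕ) (E : ℕ → (Fin (N + 1) → Fin d) → Prop) (B : ℕ → ℝ)
    (hB : ∀ k, 1 ≤ k → k ≤ K → pathProb P π N (E k) ≤ B k) :
    pathProb P π N (fun x => ∃ k, 1 ≤ k ∧ k ≤ K ∧ E k x) ≤ ∑ k ∈ Finset.Icc 1 K, B k := by
  classical
  refine le_trans ?_ (Finset.sum_le_sum fun k hk => hB k (Finset.mem_Icc.mp hk).1
    (Finset.mem_Icc.mp hk).2)
  unfold pathProb
  rw [Finset.sum_comm]
  refine Finset.sum_le_sum fun x _ => ?_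
  have hpm := pathMass_nonneg hP hπ N x
  have hnn : ∀ k, 0 ≤ (if E k x then pathMass P π N x else 0) := fun k => by
    split_ifs
    · exact hpm
    · exact le_rfl
  split_ifs with h
  · obtain ⟨k, h1, h2, h3⟩ := h
    refine le_trans ?_ (Finset.single_le_sum (fun k _ => hnn k) (Finset.mem_Icc.mpr ⟨h1, h2⟩))
    rw [if_pos h3]
  · exact Finset.sum_nonneg fun k _ => hnn k

/-- Telescoping estimate. -/
lemma tele (ξ v₀ : ℝ) (hξ : 0 < ξ) (hξ' : ξ ≤ 2 / 5) (hv : 0 < v₀) (K : ℕ) :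
    ∑ k ∈ Finset.Icc 1 K, 1 / (v₀ * (1 + ξ) ^ k + 2 + 1 / (v₀ * (1 + ξ) ^ k)) ≤ 7 / (5 * ξ) := by
  have key : ∀ K : ℕ,
      ∑ k ∈ Finset.Icc 1 K, 1 / (v₀ * (1 + ξ) ^ k + 2 + 1 / (v₀ * (1 + ξ) ^ k))
      ≤ 7 / (5 * ξ) * (1 - 1 / (1 + v₀ * (1 + ξ) ^ (K + 1))) := by
    intro K
    induction K with
    | zero =>
      simp only [zero_add, pow_one]
      rw [Finset.Icc_eq_empty (by norm_num), Finset.sum_empty]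
      have : 1 / (1 + v₀ * (1 + ξ)) ≤ 1 := by
        rw [div_le_one (by positivity)]
        nlinarith [mul_pos hv hξ]
      have h2 : 0 ≤ 7 / (5 * ξ) := by positivity
      exact mul_nonneg h2 (by linarith)
    | succ K ih =>
      rw [Finset.sum_Icc_succ_top (by omega)]
      set v := v₀ * (1 + ξ) ^ (K + 1) with hvdef
      have hv0 : 0 < v := by positivity
      have e : v₀ * (1 + ξ) ^ (K + 1 + 1) = v * (1 + ξ) := by rw [hvdef]; ring
      rw [e]
      have : 1 / (v + 2 + 1 / v)
          ≤ 7 / (5 * ξ) * (1 / (1 + v) - 1 / (1 + v * (1 + ξ))) := by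
        have e1 : 7 / (5 * ξ) * (1 / (1 + v) - 1 / (1 + v * (1 + ξ)))
          = 7 * v / (5 * (1 + v) * (1 + v * (1 + ξ))) := by
          field_simp
          ring
        have e2 : 1 / (v + 2 + 1 / v) = v / (1 + v) ^ 2 := by
          field_simp
          ring
        rw [e1, e2, div_le_div_iff₀ (by positivity) (by positivity)]
        have : 0 ≤ v * (1 + v) * (7 * (1 + v) - 5 * (1 + v * (1 + ξ))) := by
          have : 0 ≤ 7 * (1 + v) - 5 * (1 + v * (1 + ξ)) := by nlinarith
          positivity
        nlinarith
      nlinarith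
  refine (key K).trans ?_
  have h2 : 0 ≤ 7 / (5 * ξ) := by positivity
  have h3 : 0 ≤ 1 / (1 + v₀ * (1 + ξ) ^ (K + 1)) := by positivity
  nlinarith

lemma pathProb_mono {d : ℕ} {P : Matrix (Fin d) (Fin d) ℝ} (hP : IsTransMat P) {π : Fin d → ℝ}
    (hπ : ∀ i, 0 ≤ π i) (N : ℕ) (E F : (Fin (N + 1) → Fin d) → Prop) (h : ∀ x, E x → F x) :
    pathProb P π N E ≤ pathProb P π N F := by
  unfold pathProb
  refine Finset.sum_le_sum fun x _ => ?_
  have hpm := pathMass_nonneg hP hπ N x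
  by_cases hE : E x
  · simp [hE, h x hE]
  · rw [if_neg hE]
    split_ifs
    · exact hpm
    · exact le_rfl

/-- Per-look error estimate. -/
lemma term_bound (δ L M a q : ℝ) (Tk T₀ m : ℕ) (hδ : 0 < δ) (hTk : 1 ≤ Tk) (hT : Tk ≤ T₀)
    (hm : 1 ≤ m) (hL : 1 ≤ 2 * L) (hq : Real.exp (-(2 * L)) = q) (hM : M = 8 * T₀ * L / δ)
    (ha1 : ((Tk * m : ℕ) : ℝ) ≤ a) (ha2 : a ≤ 2 * ((Tk * m : ℕ) : ℝ)) :
    Real.exp (-(m * (δ + M / ((Tk * m : ℕ) : ℝ)) ^ 2 / 2)) ≤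
      q * (1 / (δ * a / M + 2 + 1 / (δ * a / M))) := by
  have hTk0 : (0 : ℝ) < Tk := by exact_mod_cast hTk
  have hm0 : (0 : ℝ) < m := by exact_mod_cast hm
  have hTT : (Tk : ℝ) ≤ T₀ := by exact_mod_cast hT
  have hT0 : (0 : ℝ) < T₀ := hTk0.trans_le hTT
  have hL0 : 0 < L := by linarith
  have hM0 : 0 < M := by rw [hM]; positivity
  push_cast at *
  set n : ℝ := (Tk : ℝ) * m with hn
  have hn0 : 0 < n := by positivity
  have ha0 : 0 < a := by linarith
  set v := δ * a / M with hv
  have hv0 : 0 < v := by positivity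
  set w := v + 2 + 1 / v with hw
  have hw0 : 2 ≤ w := by
    have : 0 < 1 / v := by positivity
    linarith
  have h1 : 2 * L * w ≤ m * (δ + M / n) ^ 2 / 2 := by
    have e1 : (m : ℝ) * (δ + M / n) ^ 2 / 2 = n * (δ + M / n) ^ 2 / (2 * Tk) := by
      rw [hn]; field_simp
    have e2 : n * (δ + M / n) ^ 2 / (2 * T₀) ≤ n * (δ + M / n) ^ 2 / (2 * Tk) := by
      gcongr
    have e3 : n * (δ + M / n) ^ 2 / (2 * T₀) = 4 * L * (δ * n / M + 2 + M / (δ * n)) := by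
      have : (T₀ : ℝ) = M * δ / (8 * L) := by rw [hM]; field_simp
      rw [this]
      field_simp
      ring
    have e4 : v / 2 ≤ δ * n / M := by
      have : v / 2 = δ * (a / 2) / M := by rw [hv]; ring
      rw [this]
      gcongr
      linarith
    have e5 : 1 / v ≤ M / (δ * n) := by
      rw [hv, one_div_div]
      gcongr
    have e6 : 0 < 1 / v := by positivity
    rw [e1]
    refine le_trans ?_ e2
    rw [e3]
    have : 2 * L * w = 4 * L * (w / 2) := by ring
    rw [this]
    gcongr
    linarith
  calc _ ≤ Real.exp (-(2 * L) + -(w - 1)) := by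
        apply Real.exp_le_exp.mpr
        nlinarith
    _ = q * Real.exp (-(w - 1)) := by rw [Real.exp_add, hq]
    _ ≤ q * (1 / w) := by
        have : 0 ≤ q := by rw [← hq]; exact (Real.exp_pos _).le
        refine mul_le_mul_of_nonneg_left ?_ this
        rw [Real.exp_neg, one_div]
        refine inv_anti₀ (by linarith) ?_
        linarith [Real.add_one_le_exp (w - 1)]

lemma core {d : ℕ} {P : Matrix (Fin d) (Fin d) ℝ} (hP : IsTransMat P) {π : Fin d → ℝ}
    (hπ : IsStationaryDist P π) (g : Fin d → ℝ) (hg : ∀ i, g i ∈ Set.Icc (0 : ℝ) 1)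
    (ν : ℝ) (hν : ∑ i, π i * g i = ν)
    (α ξ : ℝ) (hα : α ∈ Set.Ioc (0 : ℝ) (2 / 5)) (hξ : ξ ∈ Set.Ioc (0 : ℝ) (2 / 5))
    (δ : ℝ) (hδ : 0 < δ) (M : ℝ) (T₀ : ℕ)
    (hM : M = 8 * (T₀ : ℝ) * Real.log (2 / Real.sqrt (α * ξ)) / δ)
    (N₀ : ℕ) (Nk : ℕ → ℕ) (hNk : ∀ k, Nk k = ⌊(N₀ : ℝ) * (1 + ξ) ^ k⌋₊)
    (hNkpos : ∀ k, 1 ≤ k → 1 ≤ Nk k)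
    (hmix : ∀ k, 1 ≤ k → ∃ Tk, 1 ≤ Tk ∧ Tk ≤ T₀ ∧ Tk ∣ Nk k ∧
      ∀ i, ∑ j, (P ^ Tk) i j * g j ≤ ν + (δ + M / (Nk k : ℝ)) / 2)
    (K : ℕ) (E : ℕ → (Fin (Nk K + 1) → Fin d) → Prop)
    (hE : ∀ k x, 1 ≤ k → k ≤ K → E k x → (Nk k : ℝ) * (ν + (δ + M / (Nk k : ℝ))) ≤
      ∑ n : Fin (Nk K + 1), if 1 ≤ (n : ℕ) ∧ (n : ℕ) ≤ Nk k then g (x n) else 0) :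
    pathProb P π (Nk K) (fun x => ∃ k, 1 ≤ k ∧ k ≤ K ∧ E k x) ≤ α := by
  obtain ⟨hα0, hα1⟩ := hα
  obtain ⟨hξ0, hξ1⟩ := hξ
  set L := Real.log (2 / Real.sqrt (α * ξ)) with hLdef
  have hαξ : 0 < α * ξ := mul_pos hα0 hξ0
  have hq : Real.exp (-(2 * L)) = α * ξ / 4 := by
    have hpos : 0 < 2 / Real.sqrt (α * ξ) := by positivity
    have : Real.exp (-(2 * L)) = ((Real.exp L) ^ 2)⁻¹ := by
      rw [Real.exp_neg, ← Real.exp_nat_mul]; norm_num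
    rw [this, hLdef, Real.exp_log hpos, div_pow, Real.sq_sqrt hαξ.le, inv_div]
    norm_num
  have hL : 1 ≤ 2 * L := by
    have h1 : Real.exp (-(2 * L)) ≤ Real.exp (-1) := by
      rw [hq, Real.exp_neg]
      have h3 : (1 / 3 : ℝ) ≤ (Real.exp 1)⁻¹ := by
        rw [one_div]
        exact inv_anti₀ (Real.exp_pos _) (by linarith [Real.exp_one_lt_d9])
      nlinarith
    have := Real.exp_le_exp.mp h1
    linarith
  have hL0 : 0 < L := by linarith
  have hT0 : 1 ≤ T₀ := by
    obtain ⟨Tk, h1, h2, _⟩ := hmix 1 le_rfl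
    omega
  have hT0' : (0 : ℝ) < T₀ := by exact_mod_cast hT0
  have hM0 : 0 < M := by rw [hM]; positivity
  have hN0 : 0 < (N₀ : ℝ) := by
    rcases Nat.eq_zero_or_pos N₀ with h | h
    · have h1 := hNkpos 1 le_rfl
      rw [hNk 1, h] at h1
      simp at h1
    · exact_mod_cast h
  have hv₀ : 0 < δ * N₀ / M := by positivity
  have hnn : ∀ i, 0 ≤ π i := fun i => (hπ.1 i).le
  have hub := union_bound hP hnn (Nk K) K E
    (fun k => α * ξ / 4 * (1 / (δ * N₀ / M * (1 + ξ) ^ k + 2 + 1 / (δ * N₀ / M * (1 + ξ) ^ k)))) ?_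
  · refine hub.trans ?_
    rw [← Finset.mul_sum]
    have := mul_le_mul_of_nonneg_left (tele ξ (δ * N₀ / M) hξ0 hξ1 hv₀ K)
      (show 0 ≤ α * ξ / 4 by positivity)
    refine this.trans ?_
    have : α * ξ / 4 * (7 / (5 * ξ)) = 7 / 20 * α := by field_simp; ring
    rw [this]
    linarith
  · intro k hk hkK
    obtain ⟨Tk, hTk1, hTk2, ⟨m, hm⟩, hmx⟩ := hmix k hk
    have hpos := hNkpos k hk
    have hm1 : 1 ≤ m := by
      rcases Nat.eq_zero_or_pos m with h | h
      · rw [hm, h] at hpos; simp at hpos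
      · exact h
    have hle : Nk k ≤ Nk K := by
      rw [hNk k, hNk K]
      refine Nat.floor_le_floor ?_
      gcongr
      linarith
    have ha1 : (Nk k : ℝ) ≤ N₀ * (1 + ξ) ^ k := by
      rw [hNk k]
      exact Nat.floor_le (by positivity)
    have ha2 : (N₀ : ℝ) * (1 + ξ) ^ k ≤ 2 * (Nk k : ℝ) := by
      have := (Nat.lt_floor_add_one ((N₀ : ℝ) * (1 + ξ) ^ k)).le
      rw [← hNk k] at this
      have h1 : (1 : ℝ) ≤ Nk k := by exact_mod_cast hpos
      linarith
    refine (pathProb_mono hP hnn (Nk K) _ _ (fun x hx => hE k x hk hkK hx)).trans ?_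
    have hb := term_bound δ L M (N₀ * (1 + ξ) ^ k) (α * ξ / 4) Tk T₀ m hδ hTk1 hTk2 hm1 hL hq hM
      (by rw [← hm]; exact ha1) (by rw [← hm]; exact ha2)
    have e : δ * ((N₀ : ℝ) * (1 + ξ) ^ k) / M = δ * N₀ / M * (1 + ξ) ^ k := by ring
    rw [e] at hb
    refine le_trans ?_ hb
    have hc := conc hP hπ g hg ν (δ + M / (Nk k : ℝ)) hν (by positivity) Tk m (Nk K) hTk1 hm1
      (by rw [← hm]; exact hle) hmx
    rw [← hm] at hc ⊢
    exact hc

end SeqTest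

/-- error guarantee for the sequential test `𝒯_seq`
(Theorem `thm:seq-err-all-adapt`, part for `algseq`). -/
theorem sequential_test_error_bound
    {d : ℕ} (hd : 0 < d)
    (P : Matrix (Fin d) (Fin d) ℝ) (π f : Fin d → ℝ)
    (hP : IsTransMat P) (hirr : IsIrreducibleMat P) (haper : IsAperiodicMat P)
    (hπ : IsStationaryDist P π)
    (hf : ∀ i, f i ∈ Set.Icc (0 : ℝ) 1)
    (μ : ℝ) (hμ : μ = ∑ i, π i * f i)
    (α ξ : ℝ) (hα : α ∈ Set.Ioc (0 : ℝ) (2 / 5)) (hξ : ξ ∈ Set.Ioc (0 : ℝ) (2 / 5))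
    (r : ℝ) (hr : r ∈ Set.Ioo (0 : ℝ) 1) (δ : ℝ) (hδ : 0 < δ)
    (M : ℝ)
    (hM : M = 8 * (fMixTime P π f (δ / 2) : ℝ) * Real.log (2 / Real.sqrt (α * ξ)) / δ)
    (N₀ : ℕ) (hN₀ : N₀ = ⌊M * min (1 / r) (1 / (1 - r))⌋₊)
    (Nk : ℕ → ℕ) (hNk : ∀ k, Nk k = ⌊(N₀ : ℝ) * (1 + ξ) ^ k⌋₊)
    (hNkpos : ∀ k, 1 ≤ k → 1 ≤ Nk k)
    (hNkmono : ∀ k, 1 ≤ k → Nk k < Nk (k + 1))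
    (hdvd : ∀ k, 1 ≤ k → fMixTime P π f ((δ + M / (Nk k : ℝ)) / 2) ∣ Nk k) :
    ∀ K : ℕ, 1 ≤ K →
      (μ ≤ r - δ →
        pathProb P π (Nk K) (fun x => ∃ k, 1 ≤ k ∧ k ≤ K ∧
          r + M / (Nk k : ℝ) ≤
            (1 / (Nk k : ℝ)) *
              ∑ n : Fin (Nk K + 1), (if 1 ≤ (n : ℕ) ∧ (n : ℕ) ≤ Nk k then f (x n) else 0)) ≤
          α) ∧
      (r + δ ≤ μ →
        pathProb P π (Nk K) (fun x => ∃ k, 1 ≤ k ∧ k ≤ K ∧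
          (1 / (Nk k : ℝ)) *
              ∑ n : Fin (Nk K + 1), (if 1 ≤ (n : ℕ) ∧ (n : ℕ) ≤ Nk k then f (x n) else 0) ≤
            r - M / (Nk k : ℝ)) ≤
          α) := by
  intro K hK
  have hN0 : N₀ ≠ 0 := by
    intro h
    have h1 := hNkpos 1 le_rfl
    rw [hNk 1, h] at h1
    simp at h1
  have hT0 : fMixTime P π f (δ / 2) ≠ 0 := by
    intro h
    apply hN0
    rw [hN₀, hM, h]
    simp
  have hTmem := Nat.sInf_mem (Nat.nonempty_of_pos_sInf (Nat.pos_of_ne_zero hT0))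
  have hLpos : 0 ≤ Real.log (2 / Real.sqrt (α * ξ)) := by
    apply Real.log_nonneg
    have hpos : 0 < α * ξ := mul_pos hα.1 hξ.1
    rw [one_le_div (Real.sqrt_pos.mpr hpos)]
    apply Real.sqrt_le_iff.mpr
    constructor
    · norm_num
    · nlinarith [hα.1, hα.2, hξ.1, hξ.2]
  have hM0 : 0 ≤ M := by rw [hM]; positivity
  have hmix : ∀ k, 1 ≤ k → ∃ Tk, 1 ≤ Tk ∧ Tk ≤ fMixTime P π f (δ / 2) ∧ Tk ∣ Nk k ∧
      ∀ i, |∑ j, (P ^ Tk) i j * f j - μ| ≤ (δ + M / (Nk k : ℝ)) / 2 := by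
    intro k hk
    have hMk : 0 ≤ M / (Nk k : ℝ) := by positivity
    have hmem : fMixTime P π f (δ / 2) ∈ {n : ℕ | 1 ≤ n ∧
        ∀ i, fDisc f (fun j => (P ^ n) i j) π ≤ (δ + M / (Nk k : ℝ)) / 2} :=
      ⟨hTmem.1, fun i => (hTmem.2 i).trans (by linarith)⟩
    have hmem2 := Nat.sInf_mem (⟨_, hmem⟩ : Set.Nonempty _)
    refine ⟨fMixTime P π f ((δ + M / (Nk k : ℝ)) / 2), hmem2.1, Nat.sInf_le hmem, hdvd k hk, ?_⟩
    intro i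
    have := hmem2.2 i
    rw [hμ]
    exact this
  refine ⟨fun h => ?_, fun h => ?_⟩
  · refine SeqTest.core hP hπ f hf μ hμ.symm α ξ hα hξ δ hδ M _ hM N₀ Nk hNk hNkpos ?_ K
      (fun k x => r + M / (Nk k : ℝ) ≤ (1 / (Nk k : ℝ)) *
              ∑ n : Fin (Nk K + 1), (if 1 ≤ (n : ℕ) ∧ (n : ℕ) ≤ Nk k then f (x n) else 0)) ?_
    · intro k hk
      obtain ⟨Tk, h1, h2, h3, h4⟩ := hmix k hk
      exact ⟨Tk, h1, h2, h3, fun i => by linarith [(abs_le.mp (h4 i)).2]⟩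
    · intro k x hk hkK hx
      have hpos : (0 : ℝ) < Nk k := by exact_mod_cast hNkpos k hk
      rw [one_div, inv_mul_eq_div, le_div_iff₀ hpos] at hx
      nlinarith
  · refine SeqTest.core hP hπ (fun i => 1 - f i)
      (fun i => ⟨by linarith [(hf i).2], by linarith [(hf i).1]⟩) (1 - μ) ?_ α ξ hα hξ δ hδ M _ hM
      N₀ Nk hNk hNkpos ?_ K
      (fun k x => (1 / (Nk k : ℝ)) *
              ∑ n : Fin (Nk K + 1), (if 1 ≤ (n : ℕ) ∧ (n : ℕ) ≤ Nk k then f (x n) else 0) ≤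
            r - M / (Nk k : ℝ)) ?_
    · simp_rw [mul_sub, mul_one, Finset.sum_sub_distrib]
      rw [hπ.2.1, hμ]
    · intro k hk
      obtain ⟨Tk, h1, h2, h3, h4⟩ := hmix k hk
      refine ⟨Tk, h1, h2, h3, fun i => ?_⟩
      simp_rw [mul_sub, mul_one, Finset.sum_sub_distrib]
      rw [SeqTest.row_sum_pow hP]
      linarith [(abs_le.mp (h4 i)).1]
    · intro k x hk hkK hx
      have hpos : (0 : ℝ) < Nk k := by exact_mod_cast hNkpos k hk
      rw [one_div, inv_mul_eq_div, div_le_iff₀ hpos] at hx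
      have hle : Nk k ≤ Nk K := by
        rw [hNk k, hNk K]
        refine Nat.floor_le_floor ?_
        have := hξ.1
        gcongr
        linarith
      have hcount : ∑ n : Fin (Nk K + 1),
          (if 1 ≤ (n : ℕ) ∧ (n : ℕ) ≤ Nk k then (1 : ℝ) else 0) = Nk k := by
        rw [Fin.sum_univ_eq_sum_range
          (fun n => if 1 ≤ n ∧ n ≤ Nk k then (1 : ℝ) else 0) (Nk K + 1), Finset.sum_boole]
        have : (Finset.range (Nk K + 1)).filter (fun n => 1 ≤ n ∧ n ≤ Nk k)
            = Finset.Icc 1 (Nk k) := by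
          ext n
          simp only [Finset.mem_filter, Finset.mem_range, Finset.mem_Icc]
          omega
        rw [this]
        simp
      have e : ∑ n : Fin (Nk K + 1),
          (if 1 ≤ (n : ℕ) ∧ (n : ℕ) ≤ Nk k then (1 - f (x n)) else 0)
          = Nk k - ∑ n : Fin (Nk K + 1),
            (if 1 ≤ (n : ℕ) ∧ (n : ℕ) ≤ Nk k then f (x n) else 0) := by
        rw [← hcount, ← Finset.sum_sub_distrib]
        refine Finset.sum_congr rfl fun n _ => ?_
        split_ifs <;> simp
      rw [e]
      nlinarith
end
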